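/- Let U be a domain in ℂⁿ and φ, ψ ∈ C¹(U) be functions such that for every holomorphic map g : 𝔻 → U from the unit disk into U, either φ∘g or ψ∘g is holomorphic. Then either φ is holomorphic on all of U or ψ is holomorphic on all of U. -/

import Mathlib

open Metric

/-- The value on `v` of the Cauchy-Riemann operator `∂̄φ` at `x`, up to a factor `1 / 2`. -/
noncomputable def dbar {E : Type*} [NormedAddCommGroup E] [NormedSpace ℂ E]
    (φ : E → ℂ) (x v : E) : ℂ :=
  fderiv ℝ φ x v + Complex.I * fderiv ℝ φ x (Complex.I • v)

section dbar

variable {E : Type*} [NormedAddCommGroup E] [NormedSpace ℂ E] {φ : E → ℂ} {x : E}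

theorem dbar_add (v w : E) : dbar φ x (v + w) = dbar φ x v + dbar φ x w := by
  simp only [dbar, smul_add, map_add]
  ring

theorem dbar_smul (c : ℂ) (v : E) :
    dbar φ x (c • v) = (starRingEnd ℂ) c * dbar φ x v := by
  have key (d : ℂ) (w : E) : fderiv ℝ φ x (d • w) =
      d.re * fderiv ℝ φ x w + d.im * fderiv ℝ φ x (Complex.I • w) := by
    have : d • w = d.re • w + d.im • (Complex.I • w) := by
      rw [← Complex.coe_smul, ← Complex.coe_smul, smul_smul, ← add_smul, Complex.re_add_im]
    rw [this, map_add, map_smul, map_smul, Complex.real_smul, Complex.real_smul]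
  have hc : (starRingEnd ℂ) c = c.re - c.im * Complex.I := by
    apply Complex.ext <;> simp
  simp only [dbar, smul_smul]
  rw [key c, key (Complex.I * c), hc]
  simp only [Complex.I_mul_re, Complex.I_mul_im, Complex.ofReal_neg]
  linear_combination (c.im * fderiv ℝ φ x (Complex.I • v)) * (Complex.I_sq)

/-- The Cauchy-Riemann equations `∂̄φ = 0` give complex differentiability. -/
theorem differentiableAt_complex_of_dbar_eq_zero (hφ : DifferentiableAt ℝ φ x)
    (h : ∀ v, dbar φ x v = 0) : DifferentiableAt ℂ φ x := by
  have hI (v : E) : fderiv ℝ φ x (Complex.I • v) = Complex.I * fderiv ℝ φ x v := by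
    have := h v
    simp only [dbar] at this
    linear_combination (-Complex.I) * this + fderiv ℝ φ x (Complex.I • v) * Complex.I_sq
  let L : E →L[ℂ] ℂ :=
    { toFun := fderiv ℝ φ x
      map_add' := map_add _
      map_smul' := fun c v => by
        have : c • v = c.re • v + c.im • (Complex.I • v) := by
          rw [← Complex.coe_smul, ← Complex.coe_smul, smul_smul, ← add_smul, Complex.re_add_im]
        rw [this, map_add, map_smul, map_smul, hI, Complex.real_smul, Complex.real_smul,
          RingHom.id_apply, smul_eq_mul]
        linear_combination fderiv ℝ φ x v * Complex.re_add_im c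
      cont := (fderiv ℝ φ x).continuous }
  exact (differentiableAt_iff_restrictScalars ℝ hφ).2 ⟨L, rfl⟩

/-- If `φ ∘ G` is holomorphic at `ζ`, then `∂̄φ` annihilates the derivative of `G` at `ζ`. -/
theorem dbar_eq_zero_of_differentiableAt_comp {G : ℂ → E} {ζ : ℂ} {v : E}
    (hφ : DifferentiableAt ℝ φ (G ζ)) (hG : HasDerivAt G v ζ)
    (h : DifferentiableAt ℂ (φ ∘ G) ζ) : dbar φ (G ζ) v = 0 := by
  have h1 := hφ.hasFDerivAt.comp ζ (hG.hasFDerivAt.restrictScalars ℝ)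
  have h2 := (h.hasDerivAt.hasFDerivAt.restrictScalars ℝ).unique h1
  have e1 := DFunLike.congr_fun h2 1
  have e2 := DFunLike.congr_fun h2 Complex.I
  simp at e1 e2
  rw [dbar, ← e1, ← e2]
  linear_combination deriv (φ ∘ G) ζ * Complex.I_sq

/-- Adding a small nonzero multiple of a vector outside the kernel of `∂̄φ` moves any vector
outside that kernel. -/
theorem eventually_dbar_add_smul_ne_zero {a v : E} (hv : dbar φ x v ≠ 0) :
    ∀ᶠ s : ℂ in nhdsWithin 0 {0}ᶜ, dbar φ x (a + s • v) ≠ 0 := by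
  simp only [dbar_add, dbar_smul]
  by_cases ha : dbar φ x a = 0
  · filter_upwards [self_mem_nhdsWithin] with s hs
    simpa [ha, hv] using hs
  · have hc : Continuous fun s : ℂ => dbar φ x a + (starRingEnd ℂ) s * dbar φ x v := by fun_prop
    exact nhdsWithin_le_nhds (hc.continuousAt.eventually_ne (by simpa using ha))

end dbar

section disk

/-- A bounded version of the map from the disk onto a thin strip, squeezed around `[0, 1]`. -/
theorem exists_disk_near_unitInterval {ε : ℝ} (hε : 0 < ε) :
    ∃ f : ℂ → ℂ, DifferentiableOn ℂ f (ball 0 1) ∧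
      Set.MapsTo f (ball 0 1) (thickening ε (Complex.ofReal '' Set.Icc 0 1)) ∧
      (∃ a ∈ ball (0 : ℂ) 1, f a = 0 ∧ deriv f a ≠ 0) ∧
      ∃ b ∈ ball (0 : ℂ) 1, f b = 1 ∧ deriv f b ≠ 0 := by
  have hπ := Real.pi_pos
  obtain ⟨c, hc, hcε⟩ : ∃ c : ℝ, 0 < c ∧ c * Real.pi < ε / 2 :=
    ⟨ε / (4 * Real.pi), by positivity, by field_simp; norm_num⟩
  obtain ⟨τ, hτ0, hτ1, hτ⟩ : ∃ τ : ℝ, 0 < τ ∧ τ < 1 ∧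
      c * (Real.log (1 + τ) - Real.log (1 - τ)) = 1 / 2 := by
    have hE : 1 < Real.exp (1 / (2 * c)) := Real.one_lt_exp_iff.2 (by positivity)
    have hl := Real.log_exp (1 / (2 * c))
    generalize Real.exp (1 / (2 * c)) = E at hE hl
    refine ⟨(E - 1) / (E + 1), div_pos (by linarith) (by linarith),
      (div_lt_one (by linarith)).2 (by linarith), ?_⟩
    have h1 : 1 + (E - 1) / (E + 1) = 2 * E / (E + 1) := by field_simp; ring
    have h2 : 1 - (E - 1) / (E + 1) = 2 / (E + 1) := by field_simp; ring
    rw [h1, h2, ← Real.log_div (by positivity) (by positivity)]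
    have : 2 * E / (E + 1) / (2 / (E + 1)) = E := by field_simp
    rw [this, hl]
    field_simp
  obtain ⟨r, hr1, hr, hτr⟩ : ∃ r : ℝ, r < 1 ∧
      c * (Real.log (1 + r) - Real.log (1 - r)) < 1 / 2 + ε / 2 ∧ τ < r := by
    have hcont : ContinuousAt (fun r : ℝ => c * (Real.log (1 + r) - Real.log (1 - r))) τ := by
      have h1 : 1 + τ ≠ 0 := by linarith
      have h2 : 1 - τ ≠ 0 := by linarith
      fun_prop (disch := assumption)
    have hev := (eventually_lt_nhds hτ1).and
      (hcont.eventually_lt_const (u := 1 / 2 + ε / 2) (by linarith))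
    obtain ⟨r, ⟨h1, h2⟩, h3⟩ := ((hev.filter_mono nhdsWithin_le_nhds).and
      (self_mem_nhdsWithin (s := Set.Ioi τ))).exists
    exact ⟨r, h1, h2, h3⟩
  have hr0 : 0 < r := hτ0.trans hτr
  let f : ℂ → ℂ := fun z => 1 / 2 + c * (Complex.log (1 + r * z) - Complex.log (1 - r * z))
  have hre {z : ℂ} (hz : z ∈ ball (0 : ℂ) 1) : ‖(r : ℂ) * z‖ < r := by
    rw [norm_mul, Complex.norm_real, Real.norm_of_nonneg hr0.le]
    exact mul_lt_of_lt_one_right hr0 (by simpa using hz)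
  have hpos {z : ℂ} (hz : z ∈ ball (0 : ℂ) 1) :
      0 < (1 + r * z).re ∧ 0 < (1 - r * z).re := by
    have := abs_lt.1 ((Complex.abs_re_le_norm _).trans_lt (hre hz))
    rw [Complex.add_re, Complex.sub_re, Complex.one_re]
    constructor <;> linarith
  have hd {z : ℂ} (hz : z ∈ ball (0 : ℂ) 1) :
      HasDerivAt f (c * (r / (1 + r * z) + r / (1 - r * z))) z := by
    have h1 : HasDerivAt (fun z : ℂ => 1 + r * z) r z := by
      simpa using ((hasDerivAt_id z).const_mul (r : ℂ)).const_add 1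
    have h2 : HasDerivAt (fun z : ℂ => 1 - r * z) (-r) z := by
      simpa using ((hasDerivAt_id z).const_mul (r : ℂ)).const_sub 1
    have := (((h1.clog (Or.inl (hpos hz).1)).sub (h2.clog (Or.inl (hpos hz).2))).const_mul
      (c : ℂ)).const_add (1 / 2)
    exact this.congr_deriv (by ring)
  have hd0 {z : ℂ} (hz : z ∈ ball (0 : ℂ) 1) : deriv f z ≠ 0 := by
    have h1 : 1 + (r : ℂ) * z ≠ 0 := fun h => by simpa [h] using (hpos hz).1
    have h2 : 1 - (r : ℂ) * z ≠ 0 := fun h => by simpa [h] using (hpos hz).2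
    have : (c : ℂ) * (r / (1 + r * z) + r / (1 - r * z)) =
        2 * c * r / ((1 + r * z) * (1 - r * z)) := by
      field_simp
      ring
    rw [(hd hz).deriv, this]
    simp [h1, h2, hc.ne', hr0.ne']
  have hreal (t : ℝ) (ht : |t| < 1) :
      f (t / r : ℝ) = (1 / 2 + c * (Real.log (1 + t) - Real.log (1 - t)) : ℝ) := by
    obtain ⟨h1, h2⟩ := abs_lt.1 ht
    have e : (r : ℂ) * (t / r : ℝ) = t := by
      rw [← Complex.ofReal_mul, mul_div_cancel₀ _ hr0.ne']
    simp only [f, e]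
    push_cast
    rw [Complex.ofReal_log (by linarith), Complex.ofReal_log (by linarith)]
    push_cast
    rfl
  have hmem (t : ℝ) (ht : |t| = τ) : ((t / r : ℝ) : ℂ) ∈ ball (0 : ℂ) 1 := by
    rw [mem_ball_zero_iff, Complex.norm_real, Real.norm_eq_abs, abs_div, ht, abs_of_pos hr0]
    exact (div_lt_one hr0).2 hτr
  have hτabs : |τ| = τ := abs_of_pos hτ0
  have hnτ : |-τ| = τ := by rw [abs_neg, hτabs]
  refine ⟨f, fun z hz => (hd hz).differentiableAt.differentiableWithinAt, fun z hz => ?_,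
    ⟨((-τ / r : ℝ) : ℂ), hmem _ hnτ, ?_, hd0 (hmem _ hnτ)⟩,
    ⟨((τ / r : ℝ) : ℂ), hmem _ hτabs, ?_, hd0 (hmem _ hτabs)⟩⟩
  · have hlog {w : ℂ} (hw : ‖w‖ < r) :
        Real.log (1 - r) ≤ Real.log ‖1 + w‖ ∧ Real.log ‖1 + w‖ ≤ Real.log (1 + r) := by
      have h1 : 1 - ‖w‖ ≤ ‖1 + w‖ := by
        simpa using norm_sub_norm_le (1 : ℂ) (-w)
      have h2 : ‖1 + w‖ ≤ 1 + ‖w‖ := by simpa using norm_add_le (1 : ℂ) w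
      exact ⟨Real.log_le_log (by linarith) (by linarith),
        Real.log_le_log (by linarith) (by linarith)⟩
    have hl1 := hlog (hre hz)
    have hl2 := hlog (w := -(r * z)) (by simpa using hre hz)
    rw [← sub_eq_add_neg] at hl2
    have ha1 := abs_lt.1 (Complex.abs_arg_lt_pi_div_two_iff.2 (Or.inl (hpos hz).1))
    have ha2 := abs_lt.1 (Complex.abs_arg_lt_pi_div_two_iff.2 (Or.inl (hpos hz).2))
    have hfre : (f z).re = 1 / 2 + c * (Real.log ‖1 + r * z‖ - Real.log ‖1 - r * z‖) := by
      simp [f, Complex.log_re]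
    have hfim : (f z).im = c * ((1 + r * z).arg - (1 - r * z).arg) := by
      simp [f, Complex.log_im]
    have him : |(f z).im| < ε / 2 := by
      rw [hfim, abs_mul, abs_of_pos hc]
      refine lt_of_le_of_lt ?_ hcε
      gcongr
      exact abs_le.2 ⟨by linarith, by linarith⟩
    have hre1 : (f z).re < 1 + ε / 2 := by
      have : c * (Real.log ‖1 + r * z‖ - Real.log ‖1 - r * z‖) ≤
          c * (Real.log (1 + r) - Real.log (1 - r)) := by
        exact mul_le_mul_of_nonneg_left (by linarith) hc.le
      linarith
    have hre2 : -(ε / 2) < (f z).re := by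
      have : c * (Real.log ‖1 - r * z‖ - Real.log ‖1 + r * z‖) ≤
          c * (Real.log (1 + r) - Real.log (1 - r)) := by
        exact mul_le_mul_of_nonneg_left (by linarith) hc.le
      linarith
    rw [mem_thickening_iff]
    refine ⟨_, Set.mem_image_of_mem _ (Set.projIcc 0 1 zero_le_one (f z).re).2, ?_⟩
    rw [dist_eq_norm]
    refine (Complex.norm_le_abs_re_add_abs_im _).trans_lt ?_
    have : |(f z).re - (Set.projIcc (0 : ℝ) 1 zero_le_one (f z).re : ℝ)| < ε / 2 := by
      rw [Set.coe_projIcc, abs_lt]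
      rcases max_cases (0 : ℝ) (min 1 (f z).re) with h | h <;>
      rcases min_cases (1 : ℝ) (f z).re with h' | h' <;>
      constructor <;> linarith
    simp only [Complex.sub_re, Complex.ofReal_re, Complex.sub_im, Complex.ofReal_im, sub_zero]
    linarith
  · rw [hreal _ (by rw [hnτ]; exact hτ1)]
    norm_cast
    rw [← sub_eq_add_neg, sub_neg_eq_add]
    linarith
  · rw [hreal _ (by rw [hτabs]; exact hτ1)]
    norm_cast
    linarith

variable {E : Type*} [NormedAddCommGroup E] [NormedSpace ℂ E] {U : Set E}

/-- Two points of a connected open set lie on an entire curve along which `[0, 1]` stays in the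
set. -/
theorem exists_entire_curve (hU : IsOpen U) (hUc : IsConnected U) {p q : E}
    (hp : p ∈ U) (hq : q ∈ U) :
    ∃ g : ℂ → E, Differentiable ℂ g ∧ g 0 = p ∧ g 1 = q ∧
      ∀ z ∈ Complex.ofReal '' Set.Icc 0 1, g z ∈ U := by
  let : NormedSpace ℝ E := NormedSpace.restrictScalars ℝ ℂ E
  obtain ⟨γ, hγ⟩ := (hU.isConnected_iff_isPathConnected.1 hUc).joinedIn p hp q hq
  have hopen : IsOpen {F : C(unitInterval, E) | Set.MapsTo F Set.univ U} :=
    ContinuousMap.isOpen_setOfPred_mapsTo isCompact_univ hU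
  obtain ⟨N, hN, hN0⟩ := (((bernsteinApproximation_uniform γ.toContinuousMap).eventually
    (hopen.mem_nhds fun t _ => hγ t)).and (Filter.eventually_ne_atTop 0)).exists
  let g : ℂ → E := fun z => ∑ k : Fin (N + 1),
    ((N.choose k : ℂ) * z ^ (k : ℕ) * (1 - z) ^ (N - k)) • γ (bernstein.z k)
  have hg (t : unitInterval) :
      g (t : ℝ) = bernsteinApproximation N γ.toContinuousMap t := by
    rw [bernsteinApproximation.apply]
    refine Finset.sum_congr rfl fun k _ => ?_
    rw [bernstein_apply, ← Complex.coe_smul]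
    push_cast
    rfl
  refine ⟨g, by fun_prop, ?_, ?_, ?_⟩
  · simpa using hg 0
  · simpa [hN0] using hg 1
  · rintro _ ⟨t, ht, rfl⟩
    rw [hg ⟨t, ht⟩]
    exact hN (Set.mem_univ _)

end disk

/-- Disk through two points of a domain detecting the nonvanishing of `∂̄φ` and `∂̄ψ`. -/
theorem exists_holomorphic_disk_not_differentiable {E : Type*} [NormedAddCommGroup E]
    [NormedSpace ℂ E] {U : Set E} (hU : IsOpen U) (hUc : IsConnected U) {φ ψ : E → ℂ} {p q v w : E}
    (hp : p ∈ U) (hq : q ∈ U) (hφ : DifferentiableAt ℝ φ p) (hψ : DifferentiableAt ℝ ψ q)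
    (hv : dbar φ p v ≠ 0) (hw : dbar ψ q w ≠ 0) :
    ∃ g : ℂ → E, DifferentiableOn ℂ g (ball 0 1) ∧ Set.MapsTo g (ball 0 1) U ∧
      ¬ DifferentiableOn ℂ (φ ∘ g) (ball 0 1) ∧ ¬ DifferentiableOn ℂ (ψ ∘ g) (ball 0 1) := by
  obtain ⟨g₀, hg₀, hg₀p, hg₀q, hg₀U⟩ := exists_entire_curve hU hUc hp hq
  have hK : IsCompact (Complex.ofReal '' Set.Icc 0 1) :=
    isCompact_Icc.image Complex.continuous_ofReal
  let G : ℂ → ℂ → E := fun s z => g₀ z + s • ((z * (1 - z) ^ 2) • v + (z ^ 2 * (z - 1)) • w)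
  have hG (s : ℂ) : Differentiable ℂ (G s) := by fun_prop
  have hGc : Continuous fun x : ℂ × ℂ => G x.1 x.2 := by
    have := hg₀.continuous
    fun_prop
  have hGd (s z : ℂ) : HasDerivAt (G s) (deriv g₀ z + s • (((1 - z) ^ 2 - 2 * z * (1 - z)) • v +
      (2 * z * (z - 1) + z ^ 2) • w)) z := by
    have h1 : HasDerivAt (fun z : ℂ => z * (1 - z) ^ 2) ((1 - z) ^ 2 - 2 * z * (1 - z)) z := by
      refine ((hasDerivAt_id' z).mul (((hasDerivAt_id' z).const_sub 1).pow 2)).congr_deriv ?_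
      simp
      ring
    have h2 : HasDerivAt (fun z : ℂ => z ^ 2 * (z - 1)) (2 * z * (z - 1) + z ^ 2) z := by
      refine (((hasDerivAt_id' z).pow 2).mul ((hasDerivAt_id' z).sub_const 1)).congr_deriv ?_
      simp
    exact (hg₀ z).hasDerivAt.add (((h1.smul_const v).add (h2.smul_const w)).const_smul s)
  have hev : ∀ᶠ s in nhds (0 : ℂ), ∀ z ∈ Complex.ofReal '' Set.Icc 0 1, G s z ∈ U := by
    refine hK.eventually_forall_of_forall_eventually fun z hz => ?_
    exact hGc.continuousAt.eventually (hU.mem_nhds (by simpa [G] using hg₀U z hz))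
  obtain ⟨s, hsU, hsφ, hsψ⟩ := ((hev.filter_mono nhdsWithin_le_nhds).and
    ((eventually_dbar_add_smul_ne_zero (a := deriv g₀ 0) hv).and
      (eventually_dbar_add_smul_ne_zero (a := deriv g₀ 1) hw))).exists
  obtain ⟨ε, hε, hεU⟩ := hK.exists_thickening_subset_open
    (hU.preimage (hG s).continuous) hsU
  obtain ⟨f, hf, hfm, ⟨a, ha, hfa, hfa'⟩, b, hb, hfb, hfb'⟩ := exists_disk_near_unitInterval hε
  have hcomp {z : ℂ} (hz : z ∈ ball (0 : ℂ) 1) {u : E} (hu : HasDerivAt (G s) u (f z)) :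
      HasDerivAt (G s ∘ f) (deriv f z • u) z :=
    hu.scomp z (hf.differentiableAt (isOpen_ball.mem_nhds hz)).hasDerivAt
  have hGp : (G s ∘ f) a = p := by simp [G, hfa, hg₀p]
  have hGq : (G s ∘ f) b = q := by simp [G, hfb, hg₀q]
  refine ⟨G s ∘ f, (hG s).comp_differentiableOn hf, fun z hz => hεU (hfm hz), fun h => ?_,
    fun h => ?_⟩
  · have := dbar_eq_zero_of_differentiableAt_comp (hGp ▸ hφ) (hcomp ha (hGd s _))
      (h.differentiableAt (isOpen_ball.mem_nhds ha))
    rw [hGp, dbar_smul, hfa] at this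
    simp [hfa'] at this
    exact hsφ this
  · have := dbar_eq_zero_of_differentiableAt_comp (hGq ▸ hψ) (hcomp hb (hGd s _))
      (h.differentiableAt (isOpen_ball.mem_nhds hb))
    rw [hGq, dbar_smul, hfb] at this
    simp [hfb'] at this
    exact hsψ this

/-- If `φ, ψ` are `C¹` on a domain `U ⊆ ℂⁿ` and for every holomorphic map
`g : 𝔻 → U` either `φ ∘ g` or `ψ ∘ g` is holomorphic, then either `φ` or `ψ`
is holomorphic on all of `U`. -/
theorem hankel_stmt0 (n : ℕ) (U : Set (Fin n → ℂ)) (hU : IsOpen U)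
    (hUconn : IsConnected U) (φ ψ : (Fin n → ℂ) → ℂ)
    (hφ : ContDiffOn ℝ 1 φ U) (hψ : ContDiffOn ℝ 1 ψ U)
    (h : ∀ g : ℂ → Fin n → ℂ, DifferentiableOn ℂ g (ball (0 : ℂ) 1) →
      Set.MapsTo g (ball (0 : ℂ) 1) U →
      DifferentiableOn ℂ (φ ∘ g) (ball (0 : ℂ) 1) ∨
        DifferentiableOn ℂ (ψ ∘ g) (ball (0 : ℂ) 1)) :
    DifferentiableOn ℂ φ U ∨ DifferentiableOn ℂ ψ U := by
  by_contra! hne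
  have key {χ : (Fin n → ℂ) → ℂ} (hχ : ContDiffOn ℝ 1 χ U) (hn : ¬ DifferentiableOn ℂ χ U) :
      ∃ p ∈ U, DifferentiableAt ℝ χ p ∧ ∃ v, dbar χ p v ≠ 0 := by
    by_contra! hall
    refine hn fun p hp => ?_
    have hd := (hχ.differentiableOn one_ne_zero).differentiableAt (hU.mem_nhds hp)
    exact (differentiableAt_complex_of_dbar_eq_zero hd (hall p hp hd)).differentiableWithinAt
  obtain ⟨p, hp, hφp, v, hv⟩ := key hφ hne.1
  obtain ⟨q, hq, hψq, w, hw⟩ := key hψ hne.2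
  obtain ⟨g, hg, hgU, h1, h2⟩ :=
    exists_holomorphic_disk_not_differentiable hU hUconn hp hq hφp hψq hv hw
  exact (h g hg hgU).elim h1 h2
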